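/- Suppose that for every k ≥ 2, every Banach space Y, and every weakly p-sequentially continuous k-homogeneous polynomial P ∈ P(^kX, Y), the derivative P′ ∈ P(^{k−1}X, L(X,Y)) is weakly p-sequentially continuous. Then either X has the p-Schur property or X contains no isomorphic copy of ℓ_1. -/

import Mathlib

open Filter Topology Metric Set
open scoped ENNReal NNReal

section Defs

variable {X Y : Type*} [NormedAddCommGroup X] [NormedSpace ℝ X]
  [NormedAddCommGroup Y] [NormedSpace ℝ Y]

/-- A sequence `(x n)` in `X` is weakly `p`-summable if `(f (x n))ₙ ∈ ℓ_p` for every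
continuous linear functional `f` (for `p = ∞`, this means `(f (x n))ₙ ∈ c₀`). -/
def WeaklyLpSummable (p : ℝ≥0∞) (x : ℕ → X) : Prop :=
  ∀ f : X →L[ℝ] ℝ,
    if p = ⊤ then Filter.Tendsto (fun n => f (x n)) Filter.atTop (nhds 0)
    else Memℓp (fun n => f (x n)) p

/-- A sequence is weakly `p`-Cauchy if all difference sequences along pairs of strictly
monotone index sequences are weakly `p`-summable. -/
def WeaklyLpCauchy (p : ℝ≥0∞) (x : ℕ → X) : Prop :=
  ∀ m k : ℕ → ℕ, StrictMono m → StrictMono k →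
    WeaklyLpSummable p (fun i => x (m i) - x (k i))

/-- `(x n)` is weakly `p`-convergent to `x₀` if `(x n - x₀)` is weakly `p`-summable. -/
def WeaklyLpConvergentTo (p : ℝ≥0∞) (x : ℕ → X) (x₀ : X) : Prop :=
  WeaklyLpSummable p (fun n => x n - x₀)

/-- A set `K ⊆ L(X,Y)` is uniformly `p`-convergent if `lim_n sup_{T ∈ K} ‖T (x n)‖ = 0`
for every weakly `p`-summable sequence `(x n)`. -/
def UniformlyPConvergent (p : ℝ≥0∞) (K : Set (X →L[ℝ] Y)) : Prop :=
  ∀ x : ℕ → X, WeaklyLpSummable p x →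
    ∀ ε > 0, ∃ N : ℕ, ∀ n ≥ N, ∀ T ∈ K, ‖T (x n)‖ < ε

/-- `B` is `U`-bounded: contained in `U`, bounded, and at positive distance from `∂U`. -/
def UBounded (U B : Set X) : Prop :=
  B ⊆ U ∧ Bornology.IsBounded B ∧ ∃ r > 0, ∀ b ∈ B, Metric.ball b r ⊆ U

/-- A sequence is `U`-bounded if its range is a `U`-bounded set. -/
def UBoundedSeq (U : Set X) (x : ℕ → X) : Prop :=
  UBounded U (Set.range x)

/-- `f ∈ C^{1u}(U,Y)`: `f` is differentiable on `U` with derivative `f'` which is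
uniformly continuous on `U`-bounded subsets of `U`. -/
def C1u (U : Set X) (f : X → Y) (f' : X → X →L[ℝ] Y) : Prop :=
  (∀ x ∈ U, HasFDerivAt f (f' x) x) ∧
  ∀ B : Set X, UBounded U B → UniformContinuousOn f' B

/-- `T` is a `p`-convergent operator: it maps weakly `p`-summable sequences to norm-null
sequences. -/
def PConvergentOp (p : ℝ≥0∞) (T : X →L[ℝ] Y) : Prop :=
  ∀ x : ℕ → X, WeaklyLpSummable p x →
    Filter.Tendsto (fun n => ‖T (x n)‖) Filter.atTop (nhds 0)

/-- `f` is weakly `p`-sequentially continuous on `U`: it maps `U`-bounded weakly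
`p`-Cauchy sequences to norm convergent sequences. -/
def WeaklyPSeqCont (p : ℝ≥0∞) (U : Set X) (f : X → Y) : Prop :=
  ∀ x : ℕ → X, UBoundedSeq U x → WeaklyLpCauchy p x →
    ∃ l : Y, Filter.Tendsto (fun n => f (x n)) Filter.atTop (nhds l)

/-- `K` is weakly `p`-precompact: every sequence in `K` has a weakly `p`-Cauchy
subsequence. -/
def WeaklyPPrecompact (p : ℝ≥0∞) (K : Set X) : Prop :=
  ∀ x : ℕ → X, (∀ n, x n ∈ K) →
    ∃ m : ℕ → ℕ, StrictMono m ∧ WeaklyLpCauchy p (fun i => x (m i))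

end Defs

section Aux

variable {X : Type*} [NormedAddCommGroup X] [NormedSpace ℝ X]

/-- Hahn–Banach extension of a functional along an operator that is bounded below. -/
theorem exists_functional_comp_eq {E : Type*} [NormedAddCommGroup E] [NormedSpace ℝ E]
    (T : E →L[ℝ] X) {c : ℝ} (hc : 0 < c) (hT : ∀ z, c * ‖z‖ ≤ ‖T z‖) (g : E →L[ℝ] ℝ) :
    ∃ φ : X →L[ℝ] ℝ, ‖φ‖ ≤ ‖g‖ / c ∧ ∀ z, φ (T z) = g z := by
  have hinj : Function.Injective (T : E →ₗ[ℝ] X) := by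
    rw [injective_iff_map_eq_zero]
    intro z hz
    have h := hT z
    have hz' : T z = 0 := hz
    rw [hz', norm_zero] at h
    exact norm_eq_zero.1 (le_antisymm (nonpos_of_mul_nonpos_right h hc) (norm_nonneg z))
  let e := LinearEquiv.ofInjective (T : E →ₗ[ℝ] X) hinj
  let f : LinearMap.range (T : E →ₗ[ℝ] X) →L[ℝ] ℝ :=
    ((g : E →ₗ[ℝ] ℝ) ∘ₗ (e.symm : _ →ₗ[ℝ] E)).mkContinuous (‖g‖ / c) (by
      intro v
      obtain ⟨z, rfl⟩ := e.surjective v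
      have h1 : ‖e z‖ = ‖T z‖ := rfl
      have h2 : ‖g z‖ ≤ ‖g‖ * ‖z‖ := g.le_opNorm z
      have h3 : ‖z‖ ≤ ‖T z‖ / c := by
        rw [le_div_iff₀ hc, mul_comm]
        exact hT z
      simp only [LinearMap.comp_apply, LinearEquiv.coe_coe, LinearEquiv.symm_apply_apply,
        ContinuousLinearMap.coe_coe, h1]
      calc ‖g z‖ ≤ ‖g‖ * ‖z‖ := h2
        _ ≤ ‖g‖ * (‖T z‖ / c) := by gcongr
        _ = ‖g‖ / c * ‖T z‖ := by ring)
  obtain ⟨φ, hφ, hφn⟩ := exists_extension_norm_eq _ f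
  refine ⟨φ, ?_, fun z => ?_⟩
  · rw [hφn]
    exact LinearMap.mkContinuous_norm_le _ (by positivity) _
  · have h := hφ (e z)
    have h1 : ((e z : LinearMap.range (T : E →ₗ[ℝ] X)) : X) = T z := rfl
    rw [h1] at h
    rw [h]
    change g (e.symm (e z)) = g z
    rw [e.symm_apply_apply]

/-- A finite sign pattern is realised on the unit vectors of `ℓ₁` by a norm-one functional. -/
theorem exists_l1_functional (n : ℕ) (ε : ℕ → ℝ) (hε : ∀ k, |ε k| ≤ 1) :
    ∃ g : lp (fun _ : ℕ => ℝ) 1 →L[ℝ] ℝ, ‖g‖ ≤ 1 ∧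
      ∀ k < n, g (lp.single 1 k (1 : ℝ)) = ε k := by
  let L : lp (fun _ : ℕ => ℝ) 1 →ₗ[ℝ] ℝ :=
    { toFun := fun z => ∑ k ∈ Finset.range n, ε k * z k
      map_add' := fun z w => by
        simp [mul_add, Finset.sum_add_distrib]
      map_smul' := fun a z => by
        simp only [lp.coeFn_smul, Pi.smul_apply, smul_eq_mul, RingHom.id_apply, Finset.mul_sum]
        exact Finset.sum_congr rfl fun k _ => by ring }
  refine ⟨L.mkContinuous 1 fun z => ?_, LinearMap.mkContinuous_norm_le _ zero_le_one _,
    fun k hk => ?_⟩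
  · have h := lp.sum_rpow_le_norm_rpow (p := 1) (by simp) z (Finset.range n)
    simp only [ENNReal.toReal_one, Real.rpow_one] at h
    calc ‖L z‖ ≤ ∑ k ∈ Finset.range n, ‖ε k * z k‖ :=
          norm_sum_le (Finset.range n) fun k => ε k * z k
      _ ≤ ∑ k ∈ Finset.range n, ‖z k‖ := Finset.sum_le_sum fun k _ => by
          rw [norm_mul]
          exact mul_le_of_le_one_left (norm_nonneg _) (hε k)
      _ ≤ 1 * ‖z‖ := by rw [one_mul]; exact h
  · change ∑ j ∈ Finset.range n, ε j * (lp.single 1 k (1 : ℝ) : lp (fun _ : ℕ => ℝ) 1) j = ε k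
    simp [Pi.single_apply, hk]

/-- The sign pattern which is `1` on `s` and `-1` off `s`. -/
def signPattern (s : Finset ℕ) (k : ℕ) : ℝ := if k ∈ s then 1 else -1

theorem abs_signPattern (s : Finset ℕ) (k : ℕ) : |signPattern s k| = 1 := by
  unfold signPattern
  split_ifs <;> simp

theorem signPattern_mul_self (s : Finset ℕ) (k : ℕ) :
    signPattern s k * signPattern s k = 1 := by
  unfold signPattern
  split_ifs <;> simp

theorem sum_signPattern_mul_of_ne {n k l : ℕ} (hk : k < n) (hkl : k ≠ l) :
    ∑ s ∈ (Finset.range n).powerset, signPattern s k * signPattern s l = 0 := by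
  refine Finset.sum_involution (fun s _ => symmDiff s {k}) ?_ ?_ ?_ ?_
  · intro s _
    simp only [signPattern, Finset.mem_symmDiff, Finset.mem_singleton, hkl.symm]
    by_cases h1 : k ∈ s <;> by_cases h2 : l ∈ s <;> simp [h1, h2]
  · intro s _ _ h
    have : k ∈ symmDiff s {k} ↔ k ∈ s := by rw [h]
    simp [Finset.mem_symmDiff] at this
  · intro s hs
    rw [Finset.mem_powerset] at hs ⊢
    intro j hj
    simp only [Finset.mem_symmDiff, Finset.mem_singleton] at hj
    rcases hj with hj | hj
    · exact hs hj.1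
    · rw [hj.1]; exact Finset.mem_range.2 hk
  · intro s _
    simp

/-- The Rademacher averages of a family of functionals indexed by the subsets of `range n`. -/
noncomputable def rademacherAverage (n : ℕ) (φ : Finset ℕ → X →L[ℝ] ℝ) (k : ℕ) : X →L[ℝ] ℝ :=
  ∑ s ∈ (Finset.range n).powerset, ((2 : ℝ) ^ n)⁻¹ • signPattern s k • φ s

theorem rademacherAverage_apply (n : ℕ) (φ : Finset ℕ → X →L[ℝ] ℝ) (k : ℕ) (x : X) :
    rademacherAverage n φ k x =
      ∑ s ∈ (Finset.range n).powerset, ((2 : ℝ) ^ n)⁻¹ * (signPattern s k * φ s x) := by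
  simp [rademacherAverage]

theorem sum_powerset_range_const (n : ℕ) :
    ∑ _s ∈ (Finset.range n).powerset, ((2 : ℝ) ^ n)⁻¹ = 1 := by
  simp

theorem norm_rademacherAverage_le (n : ℕ) (φ : Finset ℕ → X →L[ℝ] ℝ) {C : ℝ}
    (hφ : ∀ s, ‖φ s‖ ≤ C) (k : ℕ) : ‖rademacherAverage n φ k‖ ≤ C := by
  calc ‖rademacherAverage n φ k‖
      ≤ ∑ s ∈ (Finset.range n).powerset, ‖((2 : ℝ) ^ n)⁻¹ • signPattern s k • φ s‖ :=
        norm_sum_le _ _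
    _ ≤ ∑ _s ∈ (Finset.range n).powerset, ((2 : ℝ) ^ n)⁻¹ * C := Finset.sum_le_sum fun s _ => by
        rw [norm_smul, norm_smul, Real.norm_eq_abs (signPattern s k), abs_signPattern, one_mul,
          Real.norm_of_nonneg (by positivity)]
        exact mul_le_mul_of_nonneg_left (hφ s) (by positivity)
    _ = C := by rw [← Finset.sum_mul, sum_powerset_range_const, one_mul]

theorem rademacherAverage_apply_eq_one {n k : ℕ} (φ : Finset ℕ → X →L[ℝ] ℝ) {y : X}
    (hy : ∀ s, φ s y = signPattern s k) : rademacherAverage n φ k y = 1 := by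
  rw [rademacherAverage_apply]
  simp only [hy, signPattern_mul_self, mul_one, sum_powerset_range_const]

/-- Bessel's inequality for the Rademacher averages. -/
theorem sum_rademacherAverage_sq_le (n : ℕ) (φ : Finset ℕ → X →L[ℝ] ℝ) {C : ℝ}
    (hφ : ∀ s, ‖φ s‖ ≤ C) (x : X) :
    ∑ k ∈ Finset.range n, rademacherAverage n φ k x ^ 2 ≤ (C * ‖x‖) ^ 2 := by
  set P := (Finset.range n).powerset
  set w : ℝ := ((2 : ℝ) ^ n)⁻¹
  have hw : 0 ≤ w := by positivity
  set a : ℕ → ℝ := fun k => rademacherAverage n φ k x with ha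
  have ha' : ∀ k, ∑ s ∈ P, w * (signPattern s k * φ s x) = a k := fun k =>
    (rademacherAverage_apply n φ k x).symm
  have hcross : ∑ s ∈ P, w * (φ s x * ∑ k ∈ Finset.range n, a k * signPattern s k)
      = ∑ k ∈ Finset.range n, a k ^ 2 := by
    simp only [Finset.mul_sum]
    rw [Finset.sum_comm]
    refine Finset.sum_congr rfl fun k _ => ?_
    rw [sq]
    nth_rewrite 3 [← ha' k]
    rw [Finset.mul_sum]
    exact Finset.sum_congr rfl fun s _ => by ring
  have hsq : ∑ s ∈ P, w * (∑ k ∈ Finset.range n, a k * signPattern s k) ^ 2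
      = ∑ k ∈ Finset.range n, a k ^ 2 := by
    have h1 : ∀ s, w * (∑ k ∈ Finset.range n, a k * signPattern s k) ^ 2
        = ∑ k ∈ Finset.range n, ∑ l ∈ Finset.range n,
          (w * (a k * a l)) * (signPattern s k * signPattern s l) := by
      intro s
      rw [sq, Finset.sum_mul_sum, Finset.mul_sum]
      refine Finset.sum_congr rfl fun k _ => ?_
      rw [Finset.mul_sum]
      exact Finset.sum_congr rfl fun l _ => by ring
    simp only [h1]
    rw [Finset.sum_comm]
    refine Finset.sum_congr rfl fun k hk => ?_
    rw [Finset.sum_comm, Finset.sum_eq_single k]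
    · simp only [signPattern_mul_self, mul_one]
      rw [← Finset.sum_mul, sum_powerset_range_const, one_mul, sq]
    · intro l _ hl
      rw [← Finset.mul_sum, sum_signPattern_mul_of_ne (Finset.mem_range.1 hk) hl.symm, mul_zero]
    · exact fun h => absurd hk h
  have hφx : ∑ s ∈ P, w * φ s x ^ 2 ≤ (C * ‖x‖) ^ 2 := by
    calc ∑ s ∈ P, w * φ s x ^ 2 ≤ ∑ s ∈ P, w * (C * ‖x‖) ^ 2 :=
          Finset.sum_le_sum fun s _ => by
            refine mul_le_mul_of_nonneg_left ?_ hw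
            rw [← sq_abs (φ s x)]
            exact pow_le_pow_left₀ (abs_nonneg _) ((φ s).le_of_opNorm_le (hφ s) x) 2
      _ = (C * ‖x‖) ^ 2 := by rw [← Finset.sum_mul, sum_powerset_range_const, one_mul]
  have hpos : 0 ≤ ∑ s ∈ P, w * (φ s x - ∑ k ∈ Finset.range n, a k * signPattern s k) ^ 2 :=
    Finset.sum_nonneg fun s _ => by positivity
  have hexp : ∑ s ∈ P, w * (φ s x - ∑ k ∈ Finset.range n, a k * signPattern s k) ^ 2
      = ∑ s ∈ P, w * φ s x ^ 2
        - 2 * ∑ s ∈ P, w * (φ s x * ∑ k ∈ Finset.range n, a k * signPattern s k)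
        + ∑ s ∈ P, w * (∑ k ∈ Finset.range n, a k * signPattern s k) ^ 2 := by
    rw [Finset.mul_sum, ← Finset.sum_sub_distrib, ← Finset.sum_add_distrib]
    exact Finset.sum_congr rfl fun s _ => by ring
  rw [hexp, hcross, hsq] at hpos
  linarith

theorem sum_rademacherAverage_rpow_le (n : ℕ) (φ : Finset ℕ → X →L[ℝ] ℝ) {r B : ℝ} (hr : 1 ≤ r)
    (x : ℕ → X) (J : Finset ℕ) (hB : ∀ s, ∑ j ∈ J, |φ s (x j)| ^ r ≤ B) (κ : ℕ → ℕ) :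
    ∑ j ∈ J, |rademacherAverage n φ (κ j) (x j)| ^ r ≤ B := by
  set P := (Finset.range n).powerset
  set w : ℝ := ((2 : ℝ) ^ n)⁻¹
  have hw : 0 ≤ w := by positivity
  have hpt : ∀ j, |rademacherAverage n φ (κ j) (x j)| ^ r ≤ ∑ s ∈ P, w * |φ s (x j)| ^ r := by
    intro j
    refine le_trans (Real.rpow_le_rpow (abs_nonneg _) ?_ (by linarith))
      (Real.rpow_arith_mean_le_arith_mean_rpow P (fun _ => w) (fun s => |φ s (x j)|)
        (fun _ _ => hw) (sum_powerset_range_const n) (fun _ _ => abs_nonneg _) hr)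
    rw [rademacherAverage_apply]
    refine (Finset.abs_sum_le_sum_abs _ _).trans_eq (Finset.sum_congr rfl fun s _ => ?_)
    rw [abs_mul, abs_mul, abs_signPattern, one_mul, abs_of_nonneg hw]
  calc ∑ j ∈ J, |rademacherAverage n φ (κ j) (x j)| ^ r
      ≤ ∑ j ∈ J, ∑ s ∈ P, w * |φ s (x j)| ^ r := Finset.sum_le_sum fun j _ => hpt j
    _ = ∑ s ∈ P, w * ∑ j ∈ J, |φ s (x j)| ^ r := by
        rw [Finset.sum_comm]
        simp only [Finset.mul_sum]
    _ ≤ ∑ s ∈ P, w * B := Finset.sum_le_sum fun s _ => mul_le_mul_of_nonneg_left (hB s) hw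
    _ = B := by rw [← Finset.sum_mul, sum_powerset_range_const, one_mul]

/-- A weakly `p`-summable sequence induces a bounded operator from the dual into `ℓ_p`. -/
theorem WeaklyLpSummable.exists_dual_bound {p : ℝ≥0∞} (hp : 1 ≤ p) (hp' : p ≠ ⊤) {x : ℕ → X}
    (hx : WeaklyLpSummable p x) :
    ∃ K : ℝ, 0 ≤ K ∧ ∀ (φ : X →L[ℝ] ℝ) (J : Finset ℕ),
      ∑ j ∈ J, |φ (x j)| ^ p.toReal ≤ (K * ‖φ‖) ^ p.toReal := by
  have : Fact (1 ≤ p) := ⟨hp⟩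
  have hmem : ∀ φ : X →L[ℝ] ℝ, Memℓp (fun n => φ (x n)) p := fun φ => by
    simpa [hp'] using hx φ
  have hp0 : 0 < p.toReal := ENNReal.toReal_pos (by positivity) hp'
  let L : (X →L[ℝ] ℝ) →ₗ[ℝ] lp (fun _ : ℕ => ℝ) p :=
    { toFun := fun φ => ⟨fun n => φ (x n), hmem φ⟩
      map_add' := fun φ χ => rfl
      map_smul' := fun a φ => rfl }
  have hL : Continuous L := by
    refine L.continuous_of_seq_closed_graph fun u φ z hu hLu => ?_
    ext j
    have h1 : Tendsto (fun n => (L (u n)) j) atTop (𝓝 (z j)) := by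
      rw [tendsto_iff_norm_sub_tendsto_zero] at hLu ⊢
      refine squeeze_zero (fun _ => norm_nonneg _) (fun n => ?_) hLu
      exact lp.norm_apply_le_norm (by positivity) (L (u n) - z) j
    have h2 : Tendsto (fun n => u n (x j)) atTop (𝓝 (φ (x j))) :=
      ((ContinuousLinearMap.apply ℝ ℝ (x j)).continuous.tendsto φ).comp hu
    exact tendsto_nhds_unique h1 h2
  let L' : (X →L[ℝ] ℝ) →L[ℝ] lp (fun _ : ℕ => ℝ) p := ⟨L, hL⟩
  refine ⟨‖L'‖, L'.opNorm_nonneg, fun φ J => ?_⟩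
  exact (lp.sum_rpow_le_norm_rpow hp0 (L' φ) J).trans
    (Real.rpow_le_rpow (norm_nonneg _) (L'.le_opNorm φ) hp0.le)

theorem tendsto_zero_of_sum_rpow_le {a : ℕ → ℝ} {r B : ℝ} (hr : 0 < r)
    (h : ∀ J : Finset ℕ, ∑ j ∈ J, |a j| ^ r ≤ B) : Tendsto a atTop (𝓝 0) := by
  have hs : Summable fun j => |a j| ^ r :=
    summable_of_sum_le (fun j => Real.rpow_nonneg (abs_nonneg _) _) h
  have h1 := hs.tendsto_atTop_zero.rpow_const (p := r⁻¹) (Or.inr (by positivity))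
  rw [Real.zero_rpow (by positivity)] at h1
  refine (tendsto_zero_iff_abs_tendsto_zero a).2 (h1.congr fun j => ?_)
  exact Real.rpow_rpow_inv (abs_nonneg _) hr.ne'

theorem WeaklyLpSummable.tendsto_apply {p : ℝ≥0∞} (hp : 1 ≤ p) (hp' : p ≠ ⊤) {x : ℕ → X}
    (hx : WeaklyLpSummable p x) (φ : X →L[ℝ] ℝ) : Tendsto (fun n => φ (x n)) atTop (𝓝 0) := by
  obtain ⟨K, -, hK⟩ := hx.exists_dual_bound hp hp'
  exact tendsto_zero_of_sum_rpow_le (ENNReal.toReal_pos (by positivity) hp') (hK φ)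

theorem WeaklyLpSummable.exists_norm_le {p : ℝ≥0∞} (hp : 1 ≤ p) (hp' : p ≠ ⊤) {x : ℕ → X}
    (hx : WeaklyLpSummable p x) : ∃ K : ℝ, ∀ n, ‖x n‖ ≤ K := by
  obtain ⟨K, hK0, hK⟩ := hx.exists_dual_bound hp hp'
  have hp0 : 0 < p.toReal := ENNReal.toReal_pos (by positivity) hp'
  refine ⟨K, fun n => NormedSpace.norm_le_dual_bound ℝ (x n) hK0 fun φ => ?_⟩
  have h := hK φ {n}
  rw [Finset.sum_singleton] at h
  exact (Real.rpow_le_rpow_iff (abs_nonneg _) (by positivity) hp0).1 h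

/-- If `X` contains `ℓ₁`, the Rademacher functionals yield a bounded, weak-star null sequence in
the dual, equal to `1` along a bounded sequence, which vanishes uniformly along
weakly `p`-summable sequences. -/
theorem exists_rademacher_functionals
    (T : lp (fun _ : ℕ => ℝ) 1 →L[ℝ] X) {c : ℝ} (hc : 0 < c) (hT : ∀ z, c * ‖z‖ ≤ ‖T z‖) :
    ∃ (y : ℕ → X) (ψ : ℕ → X →L[ℝ] ℝ) (C D : ℝ), (∀ k, ‖y k‖ ≤ D) ∧ (∀ k, ‖ψ k‖ ≤ C) ∧
      (∀ k, ψ k (y k) = 1) ∧ (∀ x, Tendsto (fun k => ψ k x) atTop (𝓝 0)) ∧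
      ∀ p : ℝ≥0∞, 1 ≤ p → p ≠ ⊤ → ∀ x : ℕ → X, WeaklyLpSummable p x →
        ∀ κ : ℕ → ℕ, Tendsto (fun j => ψ (κ j) (x j)) atTop (𝓝 0) := by
  let y : ℕ → X := fun k => T (lp.single 1 k (1 : ℝ))
  have hex : ∀ (n : ℕ) (s : Finset ℕ), ∃ φ : X →L[ℝ] ℝ, ‖φ‖ ≤ 1 / c ∧
      ∀ k < n, φ (y k) = signPattern s k := by
    intro n s
    obtain ⟨g, hg, hgk⟩ := exists_l1_functional n (signPattern s) fun k => (abs_signPattern s k).le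
    obtain ⟨φ, hφ, hφT⟩ := exists_functional_comp_eq T hc hT g
    exact ⟨φ, hφ.trans (by gcongr), fun k hk => (hφT _).trans (hgk k hk)⟩
  choose φ hφ hφy using hex
  let U : Ultrafilter ℕ := hyperfilter ℕ
  have hU : (U : Filter ℕ) ≤ atTop := by
    rw [← Nat.cofinite_eq_atTop]
    exact hyperfilter_le_cofinite
  have hlim : ∀ k, ∃ ψ : X →L[ℝ] ℝ, ‖ψ‖ ≤ 1 / c ∧
      ∀ x, Tendsto (fun n => rademacherAverage n (φ n) k x) U (𝓝 (ψ x)) := by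
    intro k
    have hcomp := WeakDual.isCompact_closedBall (𝕜 := ℝ) (E := X) 0 (1 / c)
    obtain ⟨χ, hχ, hχU⟩ := hcomp.ultrafilter_le_nhds'
      (U.map fun n => StrongDual.toWeakDual (rademacherAverage n (φ n) k)) (by
        rw [Ultrafilter.mem_map]
        refine Filter.univ_mem' fun n => ?_
        simpa using norm_rademacherAverage_le n (φ n) (hφ n) k)
    refine ⟨WeakDual.toStrongDual χ, by simpa using hχ, fun x => ?_⟩
    exact ((WeakDual.eval_continuous x).tendsto χ).comp hχU
  choose ψ hψ hψlim using hlim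
  refine ⟨y, ψ, 1 / c, ‖T‖, fun k => ?_, hψ, fun k => ?_, fun x => ?_, ?_⟩
  · refine (T.le_opNorm _).trans_eq ?_
    rw [lp.norm_single (by simp)]
    simp
  · refine tendsto_nhds_unique (hψlim k (y k)) (tendsto_const_nhds.congr' ?_)
    filter_upwards [hU (eventually_gt_atTop k)] with n hn
    exact (rademacherAverage_apply_eq_one (φ n) fun s => hφy n s k hn).symm
  · refine tendsto_zero_of_sum_rpow_le (r := 2) (B := (1 / c * ‖x‖) ^ 2) two_pos fun J => ?_
    simp only [Real.rpow_two, sq_abs]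
    refine le_of_tendsto (tendsto_finsetSum J fun k _ => (hψlim k x).pow 2) ?_
    filter_upwards [hU (eventually_gt_atTop (J.sup id))] with n hn
    refine le_trans (Finset.sum_le_sum_of_subset_of_nonneg ?_ fun _ _ _ => sq_nonneg _)
      (sum_rademacherAverage_sq_le n (φ n) (hφ n) x)
    exact fun k hk => Finset.mem_range.2 ((Finset.le_sup (f := id) hk).trans_lt hn)
  · intro p hp hp' x hx κ
    obtain ⟨K, hK0, hK⟩ := hx.exists_dual_bound hp hp'
    have hp0 : 0 < p.toReal := ENNReal.toReal_pos (by positivity) hp'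
    have hp1 : 1 ≤ p.toReal := by
      rw [← ENNReal.toReal_one]
      exact ENNReal.toReal_mono hp' hp
    refine tendsto_zero_of_sum_rpow_le (B := (K * (1 / c)) ^ p.toReal) hp0 fun J => ?_
    refine le_of_tendsto (tendsto_finsetSum J fun j _ =>
      (hψlim (κ j) (x j)).abs.rpow_const (Or.inr hp0.le)) (Eventually.of_forall fun n => ?_)
    refine sum_rademacherAverage_rpow_le n (φ n) hp1 x J (fun s => (hK _ J).trans ?_) κ
    exact Real.rpow_le_rpow (by positivity) (mul_le_mul_of_nonneg_left (hφ n s) hK0) hp0.le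

/-- A bounded sequence of functionals is an operator into `ℓ_∞`. -/
theorem exists_clm_of_bounded (f : ℕ → X →L[ℝ] ℝ) {C : ℝ} (hf : ∀ k, ‖f k‖ ≤ C) :
    ∃ S : X →L[ℝ] (BoundedContinuousFunction ℕ ℝ), ∀ x k, S x k = f k x := by
  have hb : ∀ x k, ‖f k x‖ ≤ C * ‖x‖ := fun x k => (f k).le_of_opNorm_le (hf k) x
  have hC : 0 ≤ C := (norm_nonneg _).trans (hf 0)
  let L : X →ₗ[ℝ] (BoundedContinuousFunction ℕ ℝ) :=
    { toFun := fun x =>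
        BoundedContinuousFunction.ofNormedAddCommGroupDiscrete (fun k => f k x) _ (hb x)
      map_add' := fun x z => by ext k; simp
      map_smul' := fun a x => by ext k; simp }
  exact ⟨L.mkContinuous C fun x => (BoundedContinuousFunction.norm_le (by positivity)).2 (hb x),
    fun x k => rfl⟩

/-- Uniform convergence can be tested along all choices of coordinates. -/
theorem BoundedContinuousFunction.tendsto_zero_of_forall_choice
    {u : ℕ → BoundedContinuousFunction ℕ ℝ}
    (h : ∀ κ : ℕ → ℕ, Tendsto (fun j => u j (κ j)) atTop (𝓝 0)) :
    Tendsto u atTop (𝓝 0) := by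
  have hκ : ∀ j, ∃ k, ‖u j‖ ≤ 2 * |u j k| := by
    intro j
    by_contra! hcon
    have h1 : ‖u j‖ ≤ ‖u j‖ / 2 := (BoundedContinuousFunction.norm_le (by positivity)).2
      fun k => by rw [Real.norm_eq_abs]; linarith [hcon k]
    have h2 := hcon 0
    have h3 := abs_nonneg (u j 0)
    linarith
  choose κ hκ using hκ
  refine squeeze_zero_norm hκ ?_
  simpa using (h κ).abs.const_mul 2

/-- In `ℓ_∞`, a bounded coordinatewise null sequence times an element of `c₀` is norm null. -/
theorem BoundedContinuousFunction.tendsto_mul_zero {u : ℕ → BoundedContinuousFunction ℕ ℝ}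
    {M : ℝ} (hM : ∀ n, ‖u n‖ ≤ M) (hu : ∀ k, Tendsto (fun n => u n k) atTop (𝓝 0))
    {z : BoundedContinuousFunction ℕ ℝ} (hz : Tendsto z atTop (𝓝 0)) :
    Tendsto (fun n => u n * z) atTop (𝓝 0) := by
  have hM0 : 0 ≤ M := (norm_nonneg _).trans (hM 0)
  rw [Metric.tendsto_atTop] at hz ⊢
  intro ε hε
  obtain ⟨m, hm⟩ := hz (ε / 2 / (M + 1)) (by positivity)
  have hfin : ∀ᶠ n in atTop, ∀ k ∈ Finset.range m, |u n k * z k| < ε / 2 := by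
    rw [Finset.eventually_all]
    intro k _
    have h := ((hu k).mul_const (z k)).abs
    rw [zero_mul, abs_zero] at h
    exact h.eventually (gt_mem_nhds (by positivity))
  obtain ⟨N, hN⟩ := eventually_atTop.1 hfin
  refine ⟨N, fun n hn => ?_⟩
  rw [dist_zero_right]
  refine lt_of_le_of_lt ((BoundedContinuousFunction.norm_le (by positivity)).2 fun k => ?_)
    (half_lt_self hε)
  rw [BoundedContinuousFunction.mul_apply, Real.norm_eq_abs]
  by_cases hk : k < m
  · exact (hN n hn k (Finset.mem_range.2 hk)).le
  · have h1 := (hm k (not_lt.1 hk)).le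
    rw [dist_zero_right, Real.norm_eq_abs] at h1
    have h2 : |u n k| ≤ M := ((u n).norm_coe_le_norm k).trans (hM n)
    rw [abs_mul]
    calc |u n k| * |z k| ≤ (M + 1) * (ε / 2 / (M + 1)) := by gcongr; linarith
      _ = ε / 2 := by field_simp

/-- The symmetric bilinear map `(x, y) ↦ S x * Q y + Q x * S y`. -/
noncomputable def symmetrizedProduct (S Q : X →L[ℝ] (BoundedContinuousFunction ℕ ℝ)) :
    ContinuousMultilinearMap ℝ (fun _ : Fin 2 => X) (BoundedContinuousFunction ℕ ℝ) :=
  (ContinuousMultilinearMap.mkPiAlgebra ℝ (Fin 2)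
      (BoundedContinuousFunction ℕ ℝ)).compContinuousLinearMap ![S, Q] +
    (ContinuousMultilinearMap.mkPiAlgebra ℝ (Fin 2)
      (BoundedContinuousFunction ℕ ℝ)).compContinuousLinearMap ![Q, S]

theorem symmetrizedProduct_apply (S Q : X →L[ℝ] (BoundedContinuousFunction ℕ ℝ))
    (v : Fin 2 → X) : symmetrizedProduct S Q v = S (v 0) * Q (v 1) + Q (v 0) * S (v 1) := by
  simp [symmetrizedProduct, Fin.prod_univ_two]

theorem symmetrizedProduct_comp_perm (S Q : X →L[ℝ] (BoundedContinuousFunction ℕ ℝ))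
    (σ : Equiv.Perm (Fin 2)) (v : Fin 2 → X) :
    symmetrizedProduct S Q (v ∘ σ) = symmetrizedProduct S Q v := by
  have hσ : (σ 0 = 0 ∧ σ 1 = 1) ∨ (σ 0 = 1 ∧ σ 1 = 0) := by
    revert σ
    decide
  simp only [symmetrizedProduct_apply, Function.comp_apply]
  rcases hσ with ⟨h0, h1⟩ | ⟨h0, h1⟩ <;> rw [h0, h1]
  ring

end Aux

/-- If, for every `k ≥ 2`, every Banach space `Y` and every weakly `p`-sequentially
continuous `k`-homogeneous polynomial `P ∈ P(^k X, Y)` (given by a symmetric continuous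
`k`-linear map `A`, `P x = A (x,…,x)`), the derivative
`P' (x) = k • A(x,…,x,·) ∈ P(^{k-1}X, L(X,Y))` is weakly `p`-sequentially continuous,
then either `X` has the `p`-Schur property or `X` contains no isomorphic copy of `ℓ₁`. -/
theorem pSchur_or_no_l1
    {X : Type} [NormedAddCommGroup X] [NormedSpace ℝ X] [CompleteSpace X]
    (p : ℝ≥0∞) (hp : 1 ≤ p) (hp' : p ≠ ⊤)
    (H : ∀ (k : ℕ) (hk : 2 ≤ k)
      (Y : Type) (_ : NormedAddCommGroup Y) (_ : NormedSpace ℝ Y) (_ : CompleteSpace Y)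
      (A : ContinuousMultilinearMap ℝ (fun _ : Fin k => X) Y),
      (∀ (σ : Equiv.Perm (Fin k)) (v : Fin k → X), A (v ∘ σ) = A v) →
      (∀ x : ℕ → X, Bornology.IsBounded (Set.range x) →
        (∃ x₀ : X, WeaklyLpConvergentTo p x x₀) →
        ∃ l : Y, Filter.Tendsto (fun n => A fun _ => x n) Filter.atTop (nhds l)) →
      (∀ x : ℕ → X, Bornology.IsBounded (Set.range x) →
        (∃ x₀ : X, WeaklyLpConvergentTo p x x₀) →
        ∃ L : X →L[ℝ] Y, Filter.Tendsto
          (fun n => (k : ℝ) • A.toContinuousLinearMap (fun _ => x n) ⟨0, by omega⟩)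
          Filter.atTop (nhds L))) :
    (∀ x : ℕ → X, WeaklyLpSummable p x →
      Filter.Tendsto (fun n => ‖x n‖) Filter.atTop (nhds 0)) ∨
    ¬ ∃ (T : lp (fun _ : ℕ => ℝ) 1 →L[ℝ] X) (c : ℝ), 0 < c ∧ ∀ z, c * ‖z‖ ≤ ‖T z‖ := by
  rw [or_iff_not_imp_right, not_not]
  rintro ⟨T, c, hc, hT⟩ x hx
  obtain ⟨y, ψ, C, D, hy, hψ, hψy, hψ0, hψp⟩ := exists_rademacher_functionals T hc hT
  choose f hf hfx using fun k => exists_dual_vector'' ℝ (x k)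
  obtain ⟨S, hS⟩ := exists_clm_of_bounded f hf
  obtain ⟨Q, hQ⟩ := exists_clm_of_bounded ψ hψ
  have hQp : ∀ u : ℕ → X, WeaklyLpSummable p u → Tendsto (fun n => Q (u n)) atTop (𝓝 0) :=
    fun u hu => BoundedContinuousFunction.tendsto_zero_of_forall_choice fun κ => by
      simpa only [hQ] using hψp p hp hp' u hu κ
  have hSQ : ∀ (u : ℕ → X) (z : X), WeaklyLpSummable p u →
      Tendsto (fun n => S (u n) * Q z) atTop (𝓝 0) := by
    intro u z hu
    obtain ⟨K, hK⟩ := hu.exists_norm_le hp hp'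
    refine BoundedContinuousFunction.tendsto_mul_zero (M := ‖S‖ * K)
      (fun n => S.le_opNorm_of_le (hK n)) (fun k => ?_) ?_
    · simpa only [hS] using hu.tendsto_apply hp hp' (f k)
    · exact (hψ0 z).congr fun k => (hQ z k).symm
  have hcont : ∀ u : ℕ → X, Bornology.IsBounded (Set.range u) →
      (∃ u₀ : X, WeaklyLpConvergentTo p u u₀) →
      ∃ l, Tendsto (fun n => symmetrizedProduct S Q fun _ => u n) atTop (𝓝 l) := by
    rintro u hub ⟨u₀, hu₀⟩
    obtain ⟨R, hR⟩ := hub.exists_norm_le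
    have hQ0 := hQp _ hu₀
    have h1 : Tendsto (fun n => S (u n) * Q (u n - u₀)) atTop (𝓝 0) := by
      refine squeeze_zero_norm (a := fun n => ‖S‖ * R * ‖Q (u n - u₀)‖) (fun n => ?_) ?_
      · exact (norm_mul_le _ _).trans (mul_le_mul_of_nonneg_right
          (S.le_opNorm_of_le (hR _ (mem_range_self n))) (norm_nonneg _))
      · simpa using hQ0.norm.const_mul (‖S‖ * R)
    have h2 := ((h1.add (hSQ _ u₀ hu₀)).add_const (S u₀ * Q u₀)).const_smul (2 : ℝ)
    refine ⟨_, h2.congr fun n => ?_⟩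
    rw [symmetrizedProduct_apply, two_smul, map_sub, map_sub]
    ring
  have hbdd : Bornology.IsBounded (Set.range x) := by
    obtain ⟨K, hK⟩ := hx.exists_norm_le hp hp'
    exact isBounded_iff_forall_norm_le.2 ⟨K, by rintro _ ⟨n, rfl⟩; exact hK n⟩
  obtain ⟨L, hL⟩ := H 2 le_rfl (BoundedContinuousFunction ℕ ℝ) inferInstance inferInstance
    inferInstance (symmetrizedProduct S Q) (symmetrizedProduct_comp_perm S Q) hcont x hbdd
    ⟨0, by simpa [WeaklyLpConvergentTo] using hx⟩
  set G : ℕ → X →L[ℝ] BoundedContinuousFunction ℕ ℝ := fun n =>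
    ((2 : ℕ) : ℝ) • (symmetrizedProduct S Q).toContinuousLinearMap (fun _ => x n) ⟨0, by omega⟩
    with hGdef
  have hG : ∀ n z, G n z = (2 : ℝ) • (S z * Q (x n) + Q z * S (x n)) := by
    intro n z
    simp [hGdef, symmetrizedProduct_apply]
  have hL0 : L = 0 := by
    ext1 z
    have h1 : Tendsto (fun n => G n z) atTop (𝓝 (L z)) :=
      ((ContinuousLinearMap.apply ℝ (BoundedContinuousFunction ℕ ℝ) z).continuous.tendsto L).comp
        hL
    have h2 : Tendsto (fun n => G n z) atTop (𝓝 0) := by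
      have h3 := (((hQp x hx).const_mul (S z)).add (hSQ x z hx)).const_smul (2 : ℝ)
      rw [mul_zero, add_zero, smul_zero] at h3
      refine h3.congr fun n => ?_
      rw [hG, mul_comm (Q z)]
    exact tendsto_nhds_unique h1 h2
  rw [hL0] at hL
  have hbound : ∀ n, ‖x n‖ ≤ ‖G n‖ * D + D * ‖Q (x n)‖ := by
    intro n
    have hD : 0 ≤ D := (norm_nonneg _).trans (hy 0)
    have h1 : |G n (y n) n| ≤ ‖G n‖ * D :=
      ((G n (y n)).norm_coe_le_norm n).trans ((G n).le_opNorm_of_le (hy n))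
    have h2 : G n (y n) n = 2 * (f n (y n) * Q (x n) n + ‖x n‖) := by
      have h3 : f n (x n) = ‖x n‖ := by simpa using hfx n
      rw [hG]
      simp [hS, hQ, hψy, h3, mul_add]
    have h4 : |f n (y n) * Q (x n) n| ≤ D * ‖Q (x n)‖ := by
      rw [abs_mul]
      refine mul_le_mul ?_ ((Q (x n)).norm_coe_le_norm n) (abs_nonneg _) hD
      simpa using (f n).le_of_opNorm_le_of_le (hf n) (hy n)
    rw [h2] at h1
    have h5 := (abs_le.1 h1).2
    have h6 := (abs_le.1 h4).1
    have h7 : 0 ≤ ‖G n‖ * D := by positivity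
    linarith
  refine squeeze_zero (fun n => norm_nonneg _) hbound ?_
  simpa using (hL.norm.mul_const D).add ((hQp x hx).norm.const_mul D)
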